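/- arXiv:1905.11782 — 9 statements merged into one kernel-verified Lean document; each statement's English description precedes it below -/
import Mathlib

section
/- Let T > 0, λ > 0, β ≠ 0, and let c : [0,T] → (0,∞) be a continuous function satisfying c(t) · exp(∫_t^T c(s) ds) = λ e^{β(T−t)} for all t ∈ [0,T]. Then ∫_t^T c(s) ds = log( 1 + (λ/β)(e^{β(T−t)} − 1) ) for all t ∈ [0,T], and consequently c(t) = ( 1/β + (1/λ − 1/β) e^{−β(T−t)} )^{−1} for all t ∈ [0,T]. -/
open MeasureTheory Set

/-- if a continuous positive `c` on `[0,T]` satisfies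
`c(t) exp(∫_t^T c) = λ e^{β(T-t)}`, then `∫_t^T c = log(1 + (λ/β)(e^{β(T-t)} - 1))`
and `c(t) = (1/β + (1/λ - 1/β) e^{-β(T-t)})⁻¹`. -/
theorem stmt_3 (T lam β : ℝ) (hT : 0 < T) (hlam : 0 < lam) (hβ : β ≠ 0)
    (c : ℝ → ℝ) (hc : ContinuousOn c (Icc 0 T)) (hcpos : ∀ t ∈ Icc 0 T, 0 < c t)
    (heq : ∀ t ∈ Icc 0 T,
      c t * Real.exp (∫ s in t..T, c s) = lam * Real.exp (β * (T - t))) :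
    ∀ t ∈ Icc 0 T,
      (∫ s in t..T, c s) = Real.log (1 + lam / β * (Real.exp (β * (T - t)) - 1)) ∧
      c t = (1 / β + (1 / lam - 1 / β) * Real.exp (-β * (T - t)))⁻¹ := by
  have hint : ∀ x ∈ Icc 0 T, IntervalIntegrable c volume x T := fun x hx =>
    (hc.mono (by
      rw [uIcc_of_le hx.2]
      exact Icc_subset_Icc_left hx.1)).intervalIntegrable
  have hderiv : ∀ x ∈ Icc 0 T,
      HasDerivWithinAt
        (fun u => Real.exp (∫ s in u..T, c s) - lam / β * Real.exp (β * (T - u)))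
        0 (Icc 0 T) x := by
    intro x hx
    have : Fact (x ∈ Icc 0 T) := ⟨hx⟩
    have hI : HasDerivWithinAt (fun u => ∫ s in u..T, c s) (-c x) (Icc 0 T) x :=
      intervalIntegral.integral_hasDerivWithinAt_left (t := Icc 0 T) (hint x hx)
        (hc.stronglyMeasurableAtFilter_nhdsWithin measurableSet_Icc x) (hc x hx)
    have hE : HasDerivWithinAt (fun u => Real.exp (β * (T - u)))
        (Real.exp (β * (T - x)) * (β * -1)) (Icc 0 T) x :=
      ((((hasDerivAt_id x).const_sub T).const_mul β).exp).hasDerivWithinAt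
    have hzero : Real.exp (∫ s in x..T, c s) * -c x -
        lam / β * (Real.exp (β * (T - x)) * (β * -1)) = 0 := by
      have hcancel : lam / β * (Real.exp (β * (T - x)) * (β * -1)) =
          -(lam * Real.exp (β * (T - x))) := by
        field_simp
      rw [hcancel, ← heq x hx]
      ring
    exact hzero ▸ hI.exp.sub (hE.const_mul (lam / β))
  have hconst := constant_of_has_deriv_right_zero
    (fun x hx => (hderiv x hx).continuousWithinAt)
    (fun x hx => (hderiv x (Ico_subset_Icc_self hx)).mono_of_mem_nhdsWithin
      (Icc_mem_nhdsGE_of_mem hx))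
  intro t ht
  have hexp : Real.exp (∫ s in t..T, c s) =
      1 + lam / β * (Real.exp (β * (T - t)) - 1) := by
    have h := (hconst t ht).trans (hconst T (right_mem_Icc.2 hT.le)).symm
    simp only [intervalIntegral.integral_same, sub_self, mul_zero, Real.exp_zero] at h
    linarith
  refine ⟨by rw [← hexp, Real.log_exp], ?_⟩
  have hct := heq t ht
  rw [neg_mul, Real.exp_neg]
  have hE := Real.exp_pos (β * (T - t))
  rw [hexp] at hct
  generalize Real.exp (β * (T - t)) = E at hct hE ⊢
  refine eq_inv_of_mul_eq_one_left ?_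
  field_simp at hct ⊢
  linarith
end

section
/- Let T > 0, λ > 0 and β ≠ 0 be real numbers, and define c : [0,T] → ℝ by c(t) = ( 1/β + (1/λ − 1/β) e^{−β(T−t)} )^{−1}. Then c is well defined (its denominator is strictly positive on [0,T]), continuous and strictly positive on [0,T], satisfies c(T) = λ, and satisfies the functional equation c(t) · exp(∫_t^T c(s) ds) = λ e^{β(T−t)} for all t ∈ [0,T]. -/
open MeasureTheory Set

/-- The reciprocal of the policy is positive up to the horizon. -/
theorem consumption_denom_pos {T lam β t : ℝ} (hlam : 0 < lam) (hβ : β ≠ 0) (ht : t ≤ T) :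
    0 < 1 / β + (1 / lam - 1 / β) * Real.exp (-β * (T - t)) := by
  have hE := Real.exp_pos (-β * (T - t))
  have h : 0 ≤ (1 - Real.exp (-β * (T - t))) / β := by
    rcases hβ.lt_or_gt with hneg | hpos
    · refine div_nonneg_of_nonpos (sub_nonpos.2 (Real.one_le_exp ?_)) hneg.le
      exact mul_nonneg (neg_nonneg.2 hneg.le) (sub_nonneg.2 ht)
    · refine div_nonneg (sub_nonneg.2 (Real.exp_le_one_iff.2 ?_)) hpos.le
      exact mul_nonpos_of_nonpos_of_nonneg (neg_nonpos.2 hpos.le) (sub_nonneg.2 ht)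
  calc 0 < (1 - Real.exp (-β * (T - t))) / β + Real.exp (-β * (T - t)) / lam :=
        add_pos_of_nonneg_of_pos h (div_pos hE hlam)
    _ = _ := by ring

/-- Where the reciprocal `D` of the policy does not vanish, `s ↦ β s - log (D s)` is an
antiderivative of the policy. -/
theorem hasDerivAt_consumption_antideriv {T lam β s : ℝ} (hβ : β ≠ 0)
    (hD : 1 / β + (1 / lam - 1 / β) * Real.exp (-β * (T - s)) ≠ 0) :
    HasDerivAt
      (fun u => β * u - Real.log (1 / β + (1 / lam - 1 / β) * Real.exp (-β * (T - u))))
      (1 / β + (1 / lam - 1 / β) * Real.exp (-β * (T - s)))⁻¹ s := by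
  have hlin : HasDerivAt (fun u => -β * (T - u)) (-β * (-1)) s :=
    ((hasDerivAt_id s).const_sub T).const_mul (-β)
  have hden := ((hlin.exp.const_mul (1 / lam - 1 / β)).const_add (1 / β)).log hD
  refine (((hasDerivAt_id s).const_mul β).sub hden).congr_deriv ?_
  rw [inv_eq_one_div, eq_div_iff hD, sub_mul, div_mul_cancel₀ _ hD]
  linear_combination mul_one_div_cancel hβ

/-- the closed-form consumption policy
`c(t) = (1/β + (1/λ - 1/β) e^{-β(T-t)})⁻¹` is well defined (positive denominator),
continuous and strictly positive on `[0,T]`, has `c(T) = λ`, and satisfies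
`c(t) exp(∫_t^T c) = λ e^{β(T-t)}`. -/
theorem stmt_4 (T lam β : ℝ) (hT : 0 < T) (hlam : 0 < lam) (hβ : β ≠ 0)
    (c : ℝ → ℝ)
    (hc : ∀ t, c t = (1 / β + (1 / lam - 1 / β) * Real.exp (-β * (T - t)))⁻¹) :
    (∀ t ∈ Icc 0 T, 0 < 1 / β + (1 / lam - 1 / β) * Real.exp (-β * (T - t))) ∧
    ContinuousOn c (Icc 0 T) ∧
    (∀ t ∈ Icc 0 T, 0 < c t) ∧
    c T = lam ∧
    (∀ t ∈ Icc 0 T,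
      c t * Real.exp (∫ s in t..T, c s) = lam * Real.exp (β * (T - t))) := by
  have hD : ∀ t ∈ Icc 0 T, 0 < 1 / β + (1 / lam - 1 / β) * Real.exp (-β * (T - t)) :=
    fun t ht => consumption_denom_pos hlam hβ ht.2
  have hcont : ContinuousOn c (Icc 0 T) := by
    rw [funext hc]
    exact ContinuousOn.inv₀ (by fun_prop) fun t ht => (hD t ht).ne'
  refine ⟨hD, hcont, fun t ht => hc t ▸ inv_pos.2 (hD t ht), by simp [hc], fun t ht => ?_⟩
  have hsub : uIcc t T ⊆ Icc 0 T := by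
    rw [uIcc_of_le ht.2]
    exact Icc_subset_Icc_left ht.1
  have hint := intervalIntegral.integral_eq_sub_of_hasDerivAt (f' := c)
    (fun s hs => hc s ▸ hasDerivAt_consumption_antideriv hβ (hD s (hsub hs)).ne')
    (hcont.mono hsub).intervalIntegrable
  have hDT : 1 / β + (1 / lam - 1 / β) * Real.exp (-β * (T - T)) = lam⁻¹ := by simp
  rw [hint, hDT, Real.log_inv, hc t]
  set D := 1 / β + (1 / lam - 1 / β) * Real.exp (-β * (T - t))
  have hDt : 0 < D := hD t ht
  rw [show β * T - -Real.log lam - (β * t - Real.log D)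
      = Real.log lam + β * (T - t) + Real.log D by ring,
    Real.exp_add, Real.exp_add, Real.exp_log hlam, Real.exp_log hDt]
  field_simp
end

section
/- Let T > 0 and λ > 0. Then the function c(t) = (T − t + 1/λ)^{−1} is the unique continuous function c : [0,T] → (0,∞) satisfying c(t) · exp(∫_t^T c(s) ds) = λ for all t ∈ [0,T]. -/
open MeasureTheory Set

/-- An integral-exponential equation with constant right-hand side determines the exponential
factor, which is affine. -/
theorem exp_integral_eq_of_mul_exp_integral_eq {d : ℝ → ℝ} {T lam t : ℝ}
    (hd : ContinuousOn d (Icc t T)) (ht : t ≤ T)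
    (h : ∀ x ∈ Icc t T, d x * Real.exp (∫ s in x..T, d s) = lam) :
    Real.exp (∫ s in t..T, d s) = 1 + lam * (T - t) := by
  have hint : IntegrableOn d (uIcc t T) := by
    rw [uIcc_of_le ht]
    exact hd.integrableOn_Icc
  have hcont : ContinuousOn (fun x => Real.exp (∫ s in x..T, d s)) (Icc t T) := by
    have := intervalIntegral.continuousOn_primitive_interval_left hint
    rw [uIcc_of_le ht] at this
    exact this.rexp
  have hderiv : ∀ x ∈ Ioo t T,
      HasDerivAt (fun x => Real.exp (∫ s in x..T, d s)) (-lam) x := by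
    intro x hx
    have hxi : IntervalIntegrable d volume x T :=
      (hd.mono (Icc_subset_Icc_left hx.1.le)).intervalIntegrable_of_Icc hx.2.le
    have hF := (intervalIntegral.integral_hasDerivAt_left hxi
      ((hd.mono Ioo_subset_Icc_self).stronglyMeasurableAtFilter isOpen_Ioo x hx)
      (hd.continuousAt (Icc_mem_nhds hx.1 hx.2))).exp
    refine hF.congr_deriv ?_
    rw [← h x (Ioo_subset_Icc_self hx)]
    ring
  have := intervalIntegral.integral_eq_sub_of_hasDerivAt_of_le ht hcont hderiv
    intervalIntegrable_const
  simp only [intervalIntegral.integral_const, intervalIntegral.integral_same, Real.exp_zero,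
    smul_eq_mul] at this
  linarith

/-- `c(t) = (T - t + 1/λ)⁻¹` is the unique continuous positive function
on `[0,T]` satisfying `c(t) exp(∫_t^T c) = λ`. -/
theorem stmt_5 (T lam : ℝ) (hT : 0 < T) (hlam : 0 < lam)
    (c : ℝ → ℝ) (hc : ∀ t, c t = (T - t + 1 / lam)⁻¹) :
    (ContinuousOn c (Icc 0 T) ∧ (∀ t ∈ Icc 0 T, 0 < c t) ∧
      (∀ t ∈ Icc 0 T, c t * Real.exp (∫ s in t..T, c s) = lam)) ∧
    (∀ d : ℝ → ℝ, ContinuousOn d (Icc 0 T) → (∀ t ∈ Icc 0 T, 0 < d t) →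
      (∀ t ∈ Icc 0 T, d t * Real.exp (∫ s in t..T, d s) = lam) →
      ∀ t ∈ Icc 0 T, d t = c t) := by
  obtain rfl : c = fun t => (T - t + 1 / lam)⁻¹ := funext hc
  have hpos : ∀ t ≤ T, 0 < T - t + 1 / lam := fun t ht =>
    add_pos_of_nonneg_of_pos (sub_nonneg.2 ht) (one_div_pos.2 hlam)
  have hcont : ContinuousOn (fun t => (T - t + 1 / lam)⁻¹) (Icc 0 T) :=
    ContinuousOn.inv₀ (by fun_prop) fun t ht => (hpos t ht.2).ne'
  refine ⟨⟨hcont, fun t ht => inv_pos.2 (hpos t ht.2), fun t ht => ?_⟩, ?_⟩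
  · have hderiv : ∀ x ∈ uIcc t T,
        HasDerivAt (fun x => -Real.log (T - x + 1 / lam)) (T - x + 1 / lam)⁻¹ x := by
      intro x hx
      rw [uIcc_of_le ht.2] at hx
      have := ((((hasDerivAt_id x).const_sub T).add_const (1 / lam)).log (hpos x hx.2).ne').neg
      refine this.congr_deriv ?_
      simp [neg_div]
    rw [intervalIntegral.integral_eq_sub_of_hasDerivAt hderiv
      ((hcont.mono (Icc_subset_Icc_left ht.1)).intervalIntegrable_of_Icc ht.2), neg_sub_neg,
      Real.exp_sub, Real.exp_log (hpos t ht.2), Real.exp_log (hpos T le_rfl), sub_self, zero_add,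
      ← mul_div_assoc, inv_mul_cancel₀ (hpos t ht.2).ne', one_div_one_div]
  · intro d hd _ h t ht
    have hexp := exp_integral_eq_of_mul_exp_integral_eq (hd.mono (Icc_subset_Icc_left ht.1)) ht.2
      fun x hx => h x (Icc_subset_Icc_left ht.1 hx)
    have hdt := h t ht
    rw [hexp] at hdt
    refine eq_inv_of_mul_eq_one_left (mul_left_cancel₀ hlam.ne' ?_)
    calc lam * (d t * (T - t + 1 / lam)) = d t * (1 + lam * (T - t)) := by
          field_simp
          ring
      _ = lam * 1 := by rw [hdt, mul_one]
end

section
/- Let T > 0 and n ≥ 1. For each i ∈ {1,…,n} let δ_i > 0, θ_i ∈ [0,1], ε_i > 0, ρ_i ∈ ℝ, and let c_i : [0,T] → (0,∞) be continuous. Define the geometric mean c̄(t) = (∏_{k=1}^n c_k(t))^{1/n}, the arithmetic mean ĉ(t) = (1/n) ∑_{k=1}^n c_k(t), the constants w = (1/n) ∑_{k=1}^n θ_k(δ_k − 1), D = (1/n) ∑_{k=1}^n δ_k ρ_k, and ε̄ = (∏_{k=1}^n ε_k^{δ_k})^{1/n}. Note that w > −1. Suppose that for every i and every t ∈ [0,T]: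 c_i(t) · exp(∫_t^T c_i(s) ds) = ε_i^{−δ_i} · c̄(t)^{−θ_i(δ_i−1)} · e^{−δ_i ρ_i (T−t)} · exp( −θ_i(δ_i−1) ∫_t^T ĉ(s) ds ). Then for every t ∈ [0,T]: c̄(t) · exp(∫_t^T ĉ(s) ds) = ε̄^{−1/(1+w)} · e^{ −D (T−t)/(1+w) }. -/
open MeasureTheory Set

/-- aggregating the individual equilibrium consumption equations
yields the geometric-mean equation
`c̄(t) exp(∫_t^T ĉ) = ε̄^{-1/(1+w)} e^{-D(T-t)/(1+w)}`, and `w > -1`. -/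
theorem stmt_6 (T : ℝ) (hT : 0 < T) (n : ℕ) (hn : 1 ≤ n)
    (δ θ ε ρ : Fin n → ℝ)
    (hδ : ∀ i, 0 < δ i) (hθ : ∀ i, θ i ∈ Icc (0:ℝ) 1) (hε : ∀ i, 0 < ε i)
    (c : Fin n → ℝ → ℝ)
    (hccont : ∀ i, ContinuousOn (c i) (Icc 0 T))
    (hcpos : ∀ i, ∀ t ∈ Icc 0 T, 0 < c i t)
    (cbar chat : ℝ → ℝ)
    (hcbar : ∀ t, cbar t = (∏ k, c k t) ^ ((1:ℝ) / n))
    (hchat : ∀ t, chat t = (1 / (n:ℝ)) * ∑ k, c k t)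
    (w D εbar : ℝ)
    (hw : w = (1 / (n:ℝ)) * ∑ k, θ k * (δ k - 1))
    (hD : D = (1 / (n:ℝ)) * ∑ k, δ k * ρ k)
    (hεbar : εbar = (∏ k, ε k ^ δ k) ^ ((1:ℝ) / n))
    (heq : ∀ i, ∀ t ∈ Icc 0 T,
      c i t * Real.exp (∫ s in t..T, c i s)
        = ε i ^ (-δ i) * cbar t ^ (-(θ i * (δ i - 1)))
          * Real.exp (-(δ i * ρ i) * (T - t))
          * Real.exp (-(θ i * (δ i - 1)) * ∫ s in t..T, chat s)) :
    w > -1 ∧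
    ∀ t ∈ Icc 0 T,
      cbar t * Real.exp (∫ s in t..T, chat s)
        = εbar ^ (-(1 / (1 + w))) * Real.exp (-D * (T - t) / (1 + w)) := by
  have hn0 : (0:ℝ) < n := by exact_mod_cast hn
  have hne : (n:ℝ) ≠ 0 := hn0.ne'
  have hw1 : 0 < 1 + w := by
    have hpos : 0 < ∑ k, (1 + θ k * (δ k - 1)) := by
      refine Finset.sum_pos (fun k _ => ?_) ⟨⟨0, hn⟩, Finset.mem_univ _⟩
      obtain ⟨h0, h1⟩ := hθ k
      rcases h0.eq_or_lt with h | h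
      · simp [← h]
      · nlinarith [mul_pos h (hδ k)]
    have hsum : 1 + w = (1 / (n:ℝ)) * ∑ k, (1 + θ k * (δ k - 1)) := by
      rw [hw, Finset.sum_add_distrib]
      simp [mul_add, hne]
    rw [hsum]
    positivity
  refine ⟨by linarith, fun t ht => ?_⟩
  have hc : ∀ k, 0 < c k t := fun k => hcpos k t ht
  have hεδ : ∀ k, 0 < ε k ^ δ k := fun k => Real.rpow_pos_of_pos (hε k) _
  have hcbar_pos : 0 < cbar t := by
    rw [hcbar]
    exact Real.rpow_pos_of_pos (Finset.prod_pos fun k _ => hc k) _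
  have hεbar_pos : 0 < εbar := by
    rw [hεbar]
    exact Real.rpow_pos_of_pos (Finset.prod_pos fun k _ => hεδ k) _
  have hlog_cbar : Real.log (cbar t) = (1 / (n:ℝ)) * ∑ k, Real.log (c k t) := by
    rw [hcbar, Real.log_rpow (Finset.prod_pos fun k _ => hc k),
      Real.log_prod fun k _ => (hc k).ne']
  have hlog_εbar : Real.log εbar = (1 / (n:ℝ)) * ∑ k, δ k * Real.log (ε k) := by
    rw [hεbar, Real.log_rpow (Finset.prod_pos fun k _ => hεδ k),
      Real.log_prod fun k _ => (hεδ k).ne']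
    simp only [Real.log_rpow (hε _)]
  have hint : ∫ s in t..T, chat s = (1 / (n:ℝ)) * ∑ k, ∫ s in t..T, c k s := by
    simp only [hchat]
    rw [intervalIntegral.integral_const_mul, intervalIntegral.integral_finsetSum]
    intro k _
    apply ContinuousOn.intervalIntegrable
    rw [uIcc_of_le ht.2]
    exact (hccont k).mono (Icc_subset_Icc_left ht.1)
  have heqt := fun k => heq k t ht
  generalize (∫ s in t..T, chat s) = I at hint heqt ⊢
  have hlog : ∀ k, Real.log (c k t) + (∫ s in t..T, c k s)
      = -(δ k * Real.log (ε k)) - (θ k * (δ k - 1)) * (Real.log (cbar t) + I)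
        - (δ k * ρ k) * (T - t) := by
    intro k
    have hεk := hε k
    have h := congrArg Real.log (heqt k)
    rw [Real.log_mul (hc k).ne' (Real.exp_ne_zero _), Real.log_mul (by positivity) (by positivity),
      Real.log_mul (by positivity) (by positivity),
      Real.log_mul (Real.rpow_pos_of_pos (hε k) _).ne' (by positivity),
      Real.log_rpow (hε k), Real.log_rpow hcbar_pos] at h
    simp only [Real.log_exp] at h
    linear_combination h
  have hmean : Real.log (cbar t) + I
      = -Real.log εbar - w * (Real.log (cbar t) + I) - D * (T - t) := by
    have hsum := Finset.sum_congr (rfl : (Finset.univ : Finset (Fin n)) = _) fun k _ => hlog k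
    simp only [Finset.sum_add_distrib, Finset.sum_sub_distrib, Finset.sum_neg_distrib,
      ← Finset.sum_mul] at hsum
    rw [hlog_εbar, hw, hD]
    linear_combination (1 / (n:ℝ)) * hsum + hlog_cbar + hint
  have hsolve : Real.log (cbar t) + I
      = Real.log εbar * (-(1 / (1 + w))) + -D * (T - t) / (1 + w) := by
    field_simp
    linear_combination hmean
  rw [Real.rpow_def_of_pos hεbar_pos, ← Real.exp_add, ← hsolve, Real.exp_add,
    Real.exp_log hcbar_pos]
end

section
/- Let T > 0 and n ≥ 1. For each i ∈ {1,…,n} let δ_i > 0, θ_i ∈ [0,1], ε_i > 0, ρ_i ∈ ℝ, and let c_i : [0,T] → (0,∞) be continuous. Define c̄(t) = (∏_{k=1}^n c_k(t))^{1/n}, ĉ(t) = (1/n) ∑_{k=1}^n c_k(t), w = (1/n) ∑_{k=1}^n θ_k(δ_k − 1) (which satisfies w > −1), D = (1/n) ∑_{k=1}^n δ_k ρ_k, and ε̄ = (∏_{k=1}^n ε_k^{δ_k})^{1/n}. Suppose that for every i and every t ∈ [0,T]: c_i(t) · exp(∫_t^T c_i(s) ds) = ε_i^{−δ_i} · c̄(t)^{−θ_i(δ_i−1)}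 · e^{−δ_i ρ_i (T−t)} · exp( −θ_i(δ_i−1) ∫_t^T ĉ(s) ds ). Then for every i and every t ∈ [0,T]: c_i(t) · exp(∫_t^T c_i(s) ds) = λ_i e^{β_i (T−t)}, where β_i = θ_i(δ_i−1) D/(1+w) − δ_i ρ_i and λ_i = ε_i^{−δ_i} ε̄^{ θ_i(δ_i−1)/(1+w) } > 0. -/
open MeasureTheory Set

/-- The average of the numbers `θ k * (δ k - 1)` with `δ k > 0` and `θ k ∈ [0, 1]` exceeds `-1`. -/
theorem neg_one_lt_average_mul_sub_one {n : ℕ} (hn : 1 ≤ n) {δ θ : Fin n → ℝ}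
    (hδ : ∀ i, 0 < δ i) (hθ : ∀ i, θ i ∈ Icc (0:ℝ) 1) :
    -1 < (1 / (n:ℝ)) * ∑ k, θ k * (δ k - 1) := by
  have hn0 : (0:ℝ) < n := by exact_mod_cast hn
  have hterm : ∀ k, -1 < θ k * (δ k - 1) := by
    intro k
    obtain ⟨h0, h1⟩ := hθ k
    rcases h0.eq_or_lt with h | h
    · simp [← h]
    · nlinarith [mul_pos h (hδ k)]
  have hsum : ∑ _k : Fin n, (-1:ℝ) < ∑ k, θ k * (δ k - 1) :=
    Finset.sum_lt_sum_of_nonempty ⟨⟨0, hn⟩, Finset.mem_univ _⟩ fun k _ => hterm k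
  simp only [Finset.sum_const, Finset.card_univ, Fintype.card_fin, nsmul_eq_mul] at hsum
  rw [one_div, ← div_eq_inv_mul, lt_div_iff₀ hn0]
  linarith

/-- A linear system in which every unknown is coupled to the others through their average only
has an explicit solution. -/
theorem eq_of_eq_sub_mul_average {n : ℕ} {L b a : Fin n → ℝ} {M w B : ℝ}
    (hM : M = (1 / (n:ℝ)) * ∑ k, L k) (hw : w = (1 / (n:ℝ)) * ∑ k, a k)
    (hB : B = (1 / (n:ℝ)) * ∑ k, b k) (hw1 : 1 + w ≠ 0)
    (h : ∀ i, L i = b i - a i * M) (i : Fin n) :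
    L i = b i - a i * (B / (1 + w)) := by
  have hsum : ∑ k, L k = ∑ k, b k - (∑ k, a k) * M := by
    rw [Finset.sum_congr rfl fun k _ => h k, Finset.sum_sub_distrib, Finset.sum_mul]
  have hMB : M = B / (1 + w) := by
    rw [eq_div_iff hw1]
    rw [hsum] at hM
    rw [hw, hB]
    linear_combination hM
  rw [h i, hMB]

/-- The logarithm of a geometric mean is the average of the logarithms. -/
theorem log_prod_rpow_one_div {n : ℕ} {x : Fin n → ℝ} (hx : ∀ k, 0 < x k) :
    Real.log ((∏ k, x k) ^ ((1:ℝ) / n)) = (1 / (n:ℝ)) * ∑ k, Real.log (x k) := by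
  rw [Real.log_rpow (Finset.prod_pos fun k _ => hx k), Real.log_prod fun k _ => (hx k).ne']

/-- the system of individual equilibrium consumption equations decouples:
each agent satisfies `c_i(t) exp(∫_t^T c_i) = λ_i e^{β_i (T-t)}` with
`β_i = θ_i(δ_i-1) D/(1+w) - δ_i ρ_i` and `λ_i = ε_i^{-δ_i} ε̄^{θ_i(δ_i-1)/(1+w)} > 0`. -/
theorem stmt_7 (T : ℝ) (hT : 0 < T) (n : ℕ) (hn : 1 ≤ n)
    (δ θ ε ρ : Fin n → ℝ)
    (hδ : ∀ i, 0 < δ i) (hθ : ∀ i, θ i ∈ Icc (0:ℝ) 1) (hε : ∀ i, 0 < ε i)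
    (c : Fin n → ℝ → ℝ)
    (hccont : ∀ i, ContinuousOn (c i) (Icc 0 T))
    (hcpos : ∀ i, ∀ t ∈ Icc 0 T, 0 < c i t)
    (cbar chat : ℝ → ℝ)
    (hcbar : ∀ t, cbar t = (∏ k, c k t) ^ ((1:ℝ) / n))
    (hchat : ∀ t, chat t = (1 / (n:ℝ)) * ∑ k, c k t)
    (w D εbar : ℝ)
    (hw : w = (1 / (n:ℝ)) * ∑ k, θ k * (δ k - 1))
    (hD : D = (1 / (n:ℝ)) * ∑ k, δ k * ρ k)
    (hεbar : εbar = (∏ k, ε k ^ δ k) ^ ((1:ℝ) / n))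
    (heq : ∀ i, ∀ t ∈ Icc 0 T,
      c i t * Real.exp (∫ s in t..T, c i s)
        = ε i ^ (-δ i) * cbar t ^ (-(θ i * (δ i - 1)))
          * Real.exp (-(δ i * ρ i) * (T - t))
          * Real.exp (-(θ i * (δ i - 1)) * ∫ s in t..T, chat s)) :
    w > -1 ∧
    ∀ i, 0 < ε i ^ (-δ i) * εbar ^ (θ i * (δ i - 1) / (1 + w)) ∧
      ∀ t ∈ Icc 0 T,
        c i t * Real.exp (∫ s in t..T, c i s)
          = ε i ^ (-δ i) * εbar ^ (θ i * (δ i - 1) / (1 + w))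
            * Real.exp ((θ i * (δ i - 1) * D / (1 + w) - δ i * ρ i) * (T - t)) := by
  have hw1 : -1 < w := hw ▸ neg_one_lt_average_mul_sub_one hn hδ hθ
  have hεbar0 : 0 < εbar := by
    rw [hεbar]
    exact Real.rpow_pos_of_pos (Finset.prod_pos fun k _ => Real.rpow_pos_of_pos (hε k) _) _
  have hlogεbar : Real.log εbar = (1 / (n:ℝ)) * ∑ k, δ k * Real.log (ε k) := by
    rw [hεbar, log_prod_rpow_one_div fun k => Real.rpow_pos_of_pos (hε k) _]
    simp only [Real.log_rpow (hε _)]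
  refine ⟨hw1, fun i => ⟨mul_pos (Real.rpow_pos_of_pos (hε i) _)
    (Real.rpow_pos_of_pos hεbar0 _), fun t ht => ?_⟩⟩
  have hint : ∀ k, IntervalIntegrable (c k) volume t T := fun k =>
    ((hccont k).mono (Icc_subset_Icc_left ht.1)).intervalIntegrable_of_Icc ht.2
  have hcbar0 : 0 < cbar t := by
    rw [hcbar]
    exact Real.rpow_pos_of_pos (Finset.prod_pos fun k _ => hcpos k t ht) _
  have hM : Real.log (cbar t) + ∫ s in t..T, chat s
      = (1 / (n:ℝ)) * ∑ k, (Real.log (c k t) + ∫ s in t..T, c k s) := by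
    simp only [hchat]
    rw [hcbar, log_prod_rpow_one_div fun k => hcpos k t ht, intervalIntegral.integral_const_mul,
      intervalIntegral.integral_finsetSum fun k _ => hint k, Finset.sum_add_distrib, mul_add]
  have hlog : ∀ k, Real.log (c k t) + ∫ s in t..T, c k s
      = (-(δ k * Real.log (ε k)) - δ k * ρ k * (T - t))
        - θ k * (δ k - 1) * (Real.log (cbar t) + ∫ s in t..T, chat s) := by
    intro k
    have h := congrArg Real.log (heq k t ht)
    have hε' := (Real.rpow_pos_of_pos (hε k) (-δ k)).ne'
    have hc' := (Real.rpow_pos_of_pos hcbar0 (-(θ k * (δ k - 1)))).ne'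
    rw [Real.log_mul (hcpos k t ht).ne' (Real.exp_ne_zero _),
      Real.log_mul (mul_ne_zero (mul_ne_zero hε' hc') (Real.exp_ne_zero _)) (Real.exp_ne_zero _),
      Real.log_mul (mul_ne_zero hε' hc') (Real.exp_ne_zero _), Real.log_mul hε' hc',
      Real.log_rpow (hε k), Real.log_rpow hcbar0] at h
    simp only [Real.log_exp] at h
    linear_combination h
  have hB : -Real.log εbar - D * (T - t)
      = (1 / (n:ℝ)) * ∑ k, (-(δ k * Real.log (ε k)) - δ k * ρ k * (T - t)) := by
    rw [hlogεbar, hD, Finset.sum_sub_distrib, Finset.sum_neg_distrib, ← Finset.sum_mul]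
    ring
  have hsol := eq_of_eq_sub_mul_average hM hw hB (by linarith) hlog i
  rw [← Real.exp_log (hcpos i t ht), ← Real.exp_add, hsol, Real.rpow_def_of_pos (hε i),
    Real.rpow_def_of_pos hεbar0, ← Real.exp_add, ← Real.exp_add]
  congr 1
  ring
end

section
/- Let n ≥ 1 be an integer. For each k ∈ {1,…,n} let μ_k > 0, δ_k > 0, θ_k ∈ [0,1], σ_k ≥ 0, ν_k ≥ 0 with σ_k + ν_k > 0. Define Σ_k = σ_k² + ν_k², γ_k = 1/(1 − (1 − θ_k/n)(1 − 1/δ_k)), D_k = σ_k² + ν_k² (1 + (δ_k − 1)θ_k/n), φ = (1/n) ∑_{k=1}^n δ_k μ_k σ_k / D_k, and ψ = (1/n) ∑_{k=1}^n θ_k(δ_k − 1) σ_k² / D_k (so that D_k > 0, γ_k > 0 and 1 + ψ > 0). Then a vector (π_1,…,π_n) ∈ ℝⁿ satisfies the best-response system π_i = γ_i ( μ_i − σ_i θ_i (1 − 1/δ_i) · (1/n) ∑_{k ≠ i} σ_k π_k ) / Σ_i for every i ∈ {1,…,n} if and only if π_i = ( δ_i μ_i − θ_i(δ_i − 1) σ_i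 · φ/(1+ψ) ) / D_i for every i ∈ {1,…,n}. -/
open Set

theorem one_add_sub_one_mul_pos {d t : ℝ} (hd : 0 < d) (ht : t ∈ Icc (0:ℝ) 1) :
    0 < 1 + (d - 1) * t := by
  obtain ⟨h0, h1⟩ := ht
  rcases h0.eq_or_lt with rfl | h
  · simp
  · nlinarith [mul_pos h hd]

theorem sq_mul_add_sq_mul_pos {s v a b : ℝ} (hs : 0 ≤ s) (hsv : 0 < s + v)
    (ha : 0 < a) (hb : 0 < b) : 0 < s ^ 2 * a + v ^ 2 * b := by
  rcases hs.eq_or_lt with rfl | h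
  · have : 0 < v := by linarith
    positivity
  · positivity

/-- One agent's best response, with the aggregate over the other agents replaced by the
aggregate `S` over all agents. -/
theorem best_response_iff {m d t s v N S p : ℝ} (hN : N ≠ 0) (hd : 0 < d)
    (he : 0 < 1 + (d - 1) * t / N) (hS : 0 < s ^ 2 + v ^ 2)
    (hD : 0 < s ^ 2 + v ^ 2 * (1 + (d - 1) * t / N)) :
    p = 1 / (1 - (1 - t / N) * (1 - 1 / d)) * (m - s * t * (1 - 1 / d) * (S - s * p / N))
        / (s ^ 2 + v ^ 2)
      ↔ p = (d * m - t * (d - 1) * s * S) / (s ^ 2 + v ^ 2 * (1 + (d - 1) * t / N)) := by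
  have hg : 1 - (1 - t / N) * (1 - 1 / d) = (1 + (d - 1) * t / N) / d := by
    field_simp
    ring
  have hr : 1 / ((1 + (d - 1) * t / N) / d) * (m - s * t * (1 - 1 / d) * (S - s * p / N))
      = (d * m - s * t * (d - 1) * (S - s * p / N)) / (1 + (d - 1) * t / N) := by
    rw [one_div_div, div_mul_eq_mul_div]
    congr 1
    field_simp
  rw [hg, hr, div_div, eq_div_iff (mul_pos he hS).ne', eq_div_iff hD.ne']
  have key : p * ((1 + (d - 1) * t / N) * (s ^ 2 + v ^ 2))
        - (d * m - s * t * (d - 1) * (S - s * p / N))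
      = p * (s ^ 2 + v ^ 2 * (1 + (d - 1) * t / N)) - (d * m - t * (d - 1) * s * S) := by
    ring
  rw [← sub_eq_zero, key, sub_eq_zero]

/-- a vector `(π_1,…,π_n)` solves the best-response system
`π_i = γ_i (μ_i - σ_i θ_i (1 - 1/δ_i) (1/n) ∑_{k≠i} σ_k π_k)/Σ_i` if and only if
it is the closed-form equilibrium `π_i = (δ_i μ_i - θ_i(δ_i-1) σ_i φ/(1+ψ))/D_i`. -/
theorem stmt_10 (n : ℕ) (hn : 1 ≤ n) (μ δ θ σ ν : Fin n → ℝ)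
    (hμ : ∀ k, 0 < μ k) (hδ : ∀ k, 0 < δ k) (hθ : ∀ k, θ k ∈ Icc (0:ℝ) 1)
    (hσ : ∀ k, 0 ≤ σ k) (hν : ∀ k, 0 ≤ ν k) (hσν : ∀ k, 0 < σ k + ν k)
    (Sgm γ D : Fin n → ℝ)
    (hSgm : ∀ k, Sgm k = σ k ^ 2 + ν k ^ 2)
    (hγ : ∀ k, γ k = 1 / (1 - (1 - θ k / n) * (1 - 1 / δ k)))
    (hD : ∀ k, D k = σ k ^ 2 + ν k ^ 2 * (1 + (δ k - 1) * θ k / n))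
    (φ ψ : ℝ)
    (hφ : φ = (1 / (n:ℝ)) * ∑ k, δ k * μ k * σ k / D k)
    (hψ : ψ = (1 / (n:ℝ)) * ∑ k, θ k * (δ k - 1) * σ k ^ 2 / D k)
    (π : Fin n → ℝ) :
    (∀ i, π i = γ i * (μ i - σ i * θ i * (1 - 1 / δ i)
          * ((1 / (n:ℝ)) * ∑ k ∈ Finset.univ.erase i, σ k * π k)) / Sgm i)
      ↔ (∀ i, π i = (δ i * μ i - θ i * (δ i - 1) * σ i * (φ / (1 + ψ))) / D i) := by
  have hn0 : (0:ℝ) < n := by exact_mod_cast hn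
  have hn1 : (1:ℝ) ≤ n := by exact_mod_cast hn
  have he : ∀ k, 0 < 1 + (δ k - 1) * θ k / n := fun k => by
    rw [mul_div_assoc]
    exact one_add_sub_one_mul_pos (hδ k)
      ⟨div_nonneg (hθ k).1 hn0.le, div_le_one_of_le₀ ((hθ k).2.trans hn1) hn0.le⟩
  have hSpos : ∀ k, 0 < σ k ^ 2 + ν k ^ 2 := fun k => by
    simpa using sq_mul_add_sq_mul_pos (hσ k) (hσν k) one_pos one_pos
  have hDpos : ∀ k, 0 < D k := fun k => by
    simpa [hD] using sq_mul_add_sq_mul_pos (hσ k) (hσν k) one_pos (he k)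
  have hψpos : 0 < 1 + ψ := by
    have hsum : 1 + ψ = (1 / (n:ℝ)) * ∑ k, (1 + θ k * (δ k - 1) * σ k ^ 2 / D k) := by
      rw [Finset.sum_add_distrib, mul_add, ← hψ]
      simp [hn0.ne']
    rw [hsum]
    refine mul_pos (one_div_pos.2 hn0) (Finset.sum_pos (fun k _ => ?_) ⟨⟨0, hn⟩, Finset.mem_univ _⟩)
    have h := sq_mul_add_sq_mul_pos (hσ k) (hσν k)
      (one_add_sub_one_mul_pos (hδ k) (hθ k)) (he k)
    have hk := hDpos k
    rw [one_add_div hk.ne']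
    refine div_pos ?_ hk
    rw [hD]
    linarith
  set S : ℝ := (1 / (n:ℝ)) * ∑ k, σ k * π k with hS
  have aggregate : ∀ c, (∀ i, π i = (δ i * μ i - θ i * (δ i - 1) * σ i * c) / D i) →
      S = φ - ψ * c := fun c h => by
    rw [hS, hφ, hψ, mul_assoc, ← mul_sub, Finset.sum_mul, ← Finset.sum_sub_distrib]
    congr 1
    refine Finset.sum_congr rfl fun k _ => ?_
    rw [h k]
    ring
  have hsys : (∀ i, π i = γ i * (μ i - σ i * θ i * (1 - 1 / δ i)
          * ((1 / (n:ℝ)) * ∑ k ∈ Finset.univ.erase i, σ k * π k)) / Sgm i)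
      ↔ ∀ i, π i = (δ i * μ i - θ i * (δ i - 1) * σ i * S) / D i := by
    refine forall_congr' fun i => ?_
    have hi : (1 / (n:ℝ)) * ∑ k ∈ Finset.univ.erase i, σ k * π k = S - σ i * π i / n := by
      rw [Finset.sum_erase_eq_sub (Finset.mem_univ i), hS]
      ring
    rw [hi, hγ, hSgm, hD]
    exact best_response_iff hn0.ne' (hδ i) (he i) (hSpos i) (hD i ▸ hDpos i)
  rw [hsys]
  constructor
  · intro h
    have hc : S = φ / (1 + ψ) := by
      rw [eq_div_iff hψpos.ne']
      linarith [aggregate S h]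
    rwa [← hc]
  · intro h
    have hc : S = φ / (1 + ψ) := by
      rw [aggregate _ h]
      field_simp
      ring
    rwa [hc]
end

section
/- Let n ≥ 1 be an integer and let μ > 0, σ > 0. For each k ∈ {1,…,n} let δ_k > 0 and θ_k ∈ [0,1], and set μ_k = μ, σ_k = σ, ν_k = 0. Define φ = (1/n) ∑_{k=1}^n δ_k μ σ / σ², ψ = (1/n) ∑_{k=1}^n θ_k(δ_k − 1), θ_crit = (1 + (1/n) ∑_{k=1}^n θ_k(δ_k − 1)) / ((1/n) ∑_{k=1}^n δ_k), and for each i define π_i = ( δ_i μ − θ_i(δ_i − 1) σ · φ/(1+ψ) ) / σ². Then θ_crit > 0 and, for every i, π_i = (μ/σ²) ( δ_i − (θ_i/θ_crit)(δ_i − 1) ). -/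
open Set

/-- single-stock specialization of the equilibrium investment strategy:
`π_i = (μ/σ²)(δ_i - (θ_i/θ_crit)(δ_i - 1))`, and `θ_crit > 0`. -/
theorem stmt_11 (n : ℕ) (hn : 1 ≤ n) (μ σ : ℝ) (hμ : 0 < μ) (hσ : 0 < σ)
    (δ θ : Fin n → ℝ) (hδ : ∀ k, 0 < δ k) (hθ : ∀ k, θ k ∈ Icc (0:ℝ) 1)
    (φ ψ θcrit : ℝ)
    (hφ : φ = (1 / (n:ℝ)) * ∑ k, δ k * μ * σ / σ ^ 2)
    (hψ : ψ = (1 / (n:ℝ)) * ∑ k, θ k * (δ k - 1))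
    (hθcrit : θcrit = (1 + (1 / (n:ℝ)) * ∑ k, θ k * (δ k - 1))
        / ((1 / (n:ℝ)) * ∑ k, δ k))
    (π : Fin n → ℝ)
    (hπ : ∀ i, π i = (δ i * μ - θ i * (δ i - 1) * σ * (φ / (1 + ψ))) / σ ^ 2) :
    0 < θcrit ∧ ∀ i, π i = μ / σ ^ 2 * (δ i - θ i / θcrit * (δ i - 1)) := by
  have hn' : (0 : ℝ) < n := by exact_mod_cast hn
  have : Nonempty (Fin n) := ⟨⟨0, hn⟩⟩
  have hA : 0 < (1 / (n : ℝ)) * ∑ k, δ k :=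
    mul_pos (by positivity) (Finset.sum_pos (fun k _ => hδ k) Finset.univ_nonempty)
  have hB : 0 < 1 + ψ := by
    have hsum : 0 < ∑ k, (1 + θ k * (δ k - 1)) := by
      refine Finset.sum_pos (fun k _ => ?_) Finset.univ_nonempty
      obtain ⟨h0, h1⟩ := hθ k
      rcases h0.eq_or_lt with h | h
      · simp [← h]
      · nlinarith [mul_pos h (hδ k)]
    have hmean : 1 + ψ = (1 / (n : ℝ)) * ∑ k, (1 + θ k * (δ k - 1)) := by
      rw [hψ, Finset.sum_add_distrib, mul_add]
      simp [hn'.ne']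
    rw [hmean]
    positivity
  have hφ' : φ = μ / σ * ((1 / (n : ℝ)) * ∑ k, δ k) := by
    rw [hφ, mul_left_comm, Finset.mul_sum (a := μ / σ)]
    congr 1
    refine Finset.sum_congr rfl fun k _ => ?_
    field_simp
  rw [← hψ] at hθcrit
  generalize (1 / (n : ℝ)) * ∑ k, δ k = A at hA hφ' hθcrit
  refine ⟨hθcrit ▸ div_pos hB hA, fun i => ?_⟩
  rw [hπ, hφ', hθcrit]
  field_simp
end

section
/- Let μ > 0 and σ > 0 with 0 < 8σ² < μ², and set r = √(1 − 8σ²/μ²) ∈ (0,1). Let θ_crit > 0 and θ ≥ 0 with θ ≠ θ_crit, and set t = θ/θ_crit. Define δ_±* = 1 + (1/2)( 1/(t − 1) ± r/|t − 1| ). Then for every real δ: (μ²/(2σ²)) (1 − δ)(1 − t)( δ − t(δ − 1) ) > 1 if and only if δ_-* < δ < δ_+*. -/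
/-- with `0 < 8σ² < μ²`, `r = √(1 - 8σ²/μ²)`, `t = θ/θ_crit ≠ 1`, and
`δ_±* = 1 + ½(1/(t-1) ± r/|t-1|)`, one has
`(μ²/(2σ²))(1-δ)(1-t)(δ - t(δ-1)) > 1 ↔ δ_-* < δ < δ_+*`. -/
theorem stmt_16 (μ σ : ℝ) (hμ : 0 < μ) (hσ : 0 < σ) (h8 : 8 * σ ^ 2 < μ ^ 2)
    (r : ℝ) (hr : r = Real.sqrt (1 - 8 * σ ^ 2 / μ ^ 2))
    (θcrit θ : ℝ) (hθc : 0 < θcrit) (hθ : 0 ≤ θ) (hne : θ ≠ θcrit)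
    (t : ℝ) (ht : t = θ / θcrit)
    (δm δp : ℝ)
    (hδm : δm = 1 + 1 / 2 * (1 / (t - 1) - r / |t - 1|))
    (hδp : δp = 1 + 1 / 2 * (1 / (t - 1) + r / |t - 1|)) :
    ∀ δ : ℝ,
      1 < μ ^ 2 / (2 * σ ^ 2) * (1 - δ) * (1 - t) * (δ - t * (δ - 1))
        ↔ δm < δ ∧ δ < δp := by
  intro δ
  have hs : t - 1 ≠ 0 := by
    rw [ht, sub_ne_zero, Ne, div_eq_one_iff_eq hθc.ne']
    exact hne
  have habs : 0 < |t - 1| := abs_pos.mpr hs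
  have hr0 : 0 ≤ r := hr ▸ Real.sqrt_nonneg _
  have hr2 : r ^ 2 = 1 - 8 * σ ^ 2 / μ ^ 2 := by
    rw [hr, Real.sq_sqrt]
    rw [sub_nonneg, div_le_one (by positivity)]
    exact h8.le
  have hquad : 1 < μ ^ 2 / (2 * σ ^ 2) * (1 - δ) * (1 - t) * (δ - t * (δ - 1))
      ↔ (2 * ((t - 1) * (δ - 1)) - 1) ^ 2 < r ^ 2 := by
    have hM : 0 < μ ^ 2 / (8 * σ ^ 2) := by positivity
    have hgap : μ ^ 2 / (2 * σ ^ 2) * (1 - δ) * (1 - t) * (δ - t * (δ - 1)) - 1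
        = μ ^ 2 / (8 * σ ^ 2) * (r ^ 2 - (2 * ((t - 1) * (δ - 1)) - 1) ^ 2) := by
      rw [hr2]
      field_simp
      ring
    rw [← sub_pos, hgap, mul_pos_iff_of_pos_left hM, sub_pos]
  have hfactor : 2 * ((t - 1) * (δ - 1)) - 1
      = 2 * ((t - 1) * (δ - 1 - 1 / 2 * (1 / (t - 1)))) := by
    field_simp
  have hdiv : 2 * (|t - 1| * |δ - 1 - 1 / 2 * (1 / (t - 1))|) < r
      ↔ |δ - 1 - 1 / 2 * (1 / (t - 1))| < 1 / 2 * (r / |t - 1|) := by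
    have hrad : 1 / 2 * (r / |t - 1|) = r / (2 * |t - 1|) := by
      field_simp
    rw [hrad, lt_div_iff₀' (by positivity), mul_assoc]
  rw [hquad, sq_lt_sq, abs_of_nonneg hr0, hfactor, abs_mul, abs_mul,
    abs_of_pos (two_pos : (0 : ℝ) < 2), hdiv, abs_lt, hδm, hδp]
  constructor <;> rintro ⟨h₁, h₂⟩ <;> constructor <;> linarith
end

section
/- Let μ > 0 and σ > 0 with 0 < 8σ² < μ², and set r = √(1 − 8σ²/μ²) ∈ (0,1). Let θ_crit > 0 and θ ≥ 0 with θ ≠ θ_crit, set t = θ/θ_crit, and define δ_±* = 1 + (1/2)( 1/(t − 1) ± r/|t − 1| ). If θ < θ_crit then δ_-* < δ_+* < 1, while if θ > θ_crit then 1 < δ_-* < δ_+*. -/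
/-- ordering of the risk-tolerance thresholds `δ_±*`:
if `θ < θ_crit` then `δ_-* < δ_+* < 1`, while if `θ > θ_crit` then `1 < δ_-* < δ_+*`. -/
theorem stmt_17 (μ σ : ℝ) (hμ : 0 < μ) (hσ : 0 < σ) (h8 : 8 * σ ^ 2 < μ ^ 2)
    (r : ℝ) (hr : r = Real.sqrt (1 - 8 * σ ^ 2 / μ ^ 2))
    (θcrit θ : ℝ) (hθc : 0 < θcrit) (hθ : 0 ≤ θ) (hne : θ ≠ θcrit)
    (t : ℝ) (ht : t = θ / θcrit)
    (δm δp : ℝ)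
    (hδm : δm = 1 + 1 / 2 * (1 / (t - 1) - r / |t - 1|))
    (hδp : δp = 1 + 1 / 2 * (1 / (t - 1) + r / |t - 1|)) :
    (θ < θcrit → δm < δp ∧ δp < 1) ∧ (θcrit < θ → 1 < δm ∧ δm < δp) := by
  have hμ2 : 0 < μ ^ 2 := by positivity
  have hq0 : 0 < 8 * σ ^ 2 / μ ^ 2 := by positivity
  have hq1 : 8 * σ ^ 2 / μ ^ 2 < 1 := (div_lt_one hμ2).2 h8
  have hr0 : 0 < r := hr ▸ Real.sqrt_pos.2 (by linarith)
  have hr1 : r < 1 := by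
    rw [hr, Real.sqrt_lt' one_pos]
    linarith
  constructor
  · intro h
    have ht1 : 0 < 1 - t := by
      rw [ht, sub_pos]
      exact (div_lt_one hθc).2 h
    have habs : |t - 1| = 1 - t := by
      rw [abs_of_neg (by linarith)]
      ring
    have hinv : 1 / (t - 1) = -(1 / (1 - t)) := by
      rw [← neg_sub 1 t, div_neg]
    have hpos : 0 < r / (1 - t) := div_pos hr0 ht1
    have hlt : r / (1 - t) < 1 / (1 - t) := div_lt_div_of_pos_right hr1 ht1
    rw [hδm, hδp, habs, hinv]
    constructor <;> linarith
  · intro h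
    have ht1 : 0 < t - 1 := by
      rw [ht, sub_pos]
      exact (one_lt_div hθc).2 h
    have hpos : 0 < r / (t - 1) := div_pos hr0 ht1
    have hlt : r / (t - 1) < 1 / (t - 1) := div_lt_div_of_pos_right hr1 ht1
    rw [hδm, hδp, abs_of_pos ht1]
    constructor <;> linarith
end
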